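/- arXiv:1109.3552 — 9 statements merged into one kernel-verified Lean document; each statement's English description precedes it below -/
import Mathlib

section
/- Let n be a natural number, let P : Fin n → Fin n → Fin n → ℝ be totally antisymmetric (P changes sign under any transposition of its three arguments), let R : Fin n → Fin n → Fin n → Fin n → ℝ satisfy R μ ν κ λ = − R ν μ κ λ and R μ ν κ λ = − R μ ν λ κ for all indices, and let c be a real number. Define C μ ν κ λ = R μ ν κ λ + c · Σ_ρ P μ ν ρ · P ρ κ λ. If C satisfies the first Bianchi (cyclic) identity C μ ν κ λ + C μ κ λ ν + C μ λ ν κ = 0 for all indices, then R has the interchange symmetry R μ ν κ λ = R κ λ μ ν for all indices. -/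
/-- A rank-four tensor that is antisymmetric in each index pair and satisfies the cyclic
identity is symmetric under interchange of the pairs. -/
theorem pair_symm_of_cyclic {ι A : Type*} [AddCommGroup A] [IsAddTorsionFree A]
    {T : ι → ι → ι → ι → A}
    (h₁ : ∀ i j k l, T i j k l = - T j i k l) (h₂ : ∀ i j k l, T i j k l = - T i j l k)
    (hcyc : ∀ i j k l, T i j k l + T i k l j + T i l j k = 0) (i j k l : ι) :
    T i j k l = T k l i j := by
  have e₁ := hcyc i j k l
  have e₂ := hcyc j k l i
  have e₃ := hcyc k l i j
  have e₄ := hcyc l i j k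
  rw [h₂ j k l i, h₁ j l i k, h₁ j i k l] at e₂
  rw [h₁ k i j l, h₂ i k j l, h₁ k j l i, h₂ j k l i] at e₃
  rw [h₁ l i j k, h₂ l j k i, h₁ l k i j] at e₄
  have key : (2 : ℕ) • T i j k l = (2 : ℕ) • T k l i j := by
    grind
  exact nsmul_right_injective two_ne_zero key

/-- The contraction of an alternating rank-three tensor with itself is symmetric under
interchange of the two pairs of free indices. -/
theorem sum_mul_pair_symm {ι A : Type*} [Fintype ι] [CommRing A] {P : ι → ι → ι → A}
    (h₁ : ∀ a b d, P a b d = - P b a d) (h₂ : ∀ a b d, P a b d = - P a d b) (i j k l : ι) :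
    ∑ r, P i j r * P r k l = ∑ r, P k l r * P r i j := by
  refine Finset.sum_congr rfl fun r _ => ?_
  rw [h₂ i j r, h₁ i r j, h₁ r k l, h₂ k r l]
  ring

/-- Proposition 3.2 of the paper: if `R` is antisymmetric in its first and second index
pairs, `P` is totally antisymmetric, and the modified tensor
`C μ ν κ λ = R μ ν κ λ + c • Σ_ρ P μ ν ρ * P ρ κ λ` satisfies the first Bianchi (cyclic)
identity, then `R` has the interchange symmetry. -/
theorem interchange_symmetry_of_bianchi (n : ℕ)
    (P : Fin n → Fin n → Fin n → ℝ) (R : Fin n → Fin n → Fin n → Fin n → ℝ) (c : ℝ)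
    (hP1 : ∀ a b d, P a b d = - P b a d)
    (hP2 : ∀ a b d, P a b d = - P a d b)
    (hR1 : ∀ μ ν κ lam, R μ ν κ lam = - R ν μ κ lam)
    (hR2 : ∀ μ ν κ lam, R μ ν κ lam = - R μ ν lam κ)
    (C : Fin n → Fin n → Fin n → Fin n → ℝ)
    (hC : ∀ μ ν κ lam, C μ ν κ lam = R μ ν κ lam + c * ∑ ρ, P μ ν ρ * P ρ κ lam)
    (hBianchi : ∀ μ ν κ lam, C μ ν κ lam + C μ κ lam ν + C μ lam ν κ = 0) :
    ∀ μ ν κ lam, R μ ν κ lam = R κ lam μ ν := by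
  have hS := sum_mul_pair_symm hP1 hP2
  have hS1 : ∀ μ ν κ lam, ∑ ρ, P μ ν ρ * P ρ κ lam = - ∑ ρ, P ν μ ρ * P ρ κ lam := by
    intro μ ν κ lam
    rw [← Finset.sum_neg_distrib]
    exact Finset.sum_congr rfl fun ρ _ => by rw [hP1 μ ν ρ, neg_mul]
  have hC1 : ∀ μ ν κ lam, C μ ν κ lam = - C ν μ κ lam := by
    intro μ ν κ lam
    rw [hC, hC, hR1, hS1]
    ring
  have hC2 : ∀ μ ν κ lam, C μ ν κ lam = - C μ ν lam κ := by
    intro μ ν κ lam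
    rw [hC, hC, hR2, hS μ ν κ lam, hS1, hS lam κ μ ν]
    ring
  intro μ ν κ lam
  have h := pair_symm_of_cyclic hC1 hC2 hBianchi μ ν κ lam
  rwa [hC, hC, hS μ ν κ lam, add_left_inj] at h
end

section
/- Let ψ : ℝ → ℝ be differentiable with ψ'(τ) = 2(ψ(τ)² − ψ(τ)) for all τ ∈ ℝ, and suppose ψ(τ₁) ∈ (0,1) for some τ₁ ∈ ℝ. Then there exists τ₀ ∈ ℝ such that ψ(τ) = (1 + e^{2(τ−τ₀)})⁻¹ for all τ ∈ ℝ. -/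
/-- A solution of the homogeneous linear ODE `y' = a y` with continuous coefficient that
vanishes at one time vanishes identically. -/
theorem eq_zero_of_hasDerivAt_mul_self {a y : ℝ → ℝ} (ha : Continuous a)
    (hy : ∀ t, HasDerivAt y (a t * y t) t) {t₁ : ℝ} (h₁ : y t₁ = 0) (t : ℝ) : y t = 0 := by
  have hA (s : ℝ) : HasDerivAt (fun s ↦ ∫ x in t₁..s, a x) (a s) s :=
    ha.integral_hasStrictDerivAt t₁ s |>.hasDerivAt
  have hz (s : ℝ) : HasDerivAt (fun s ↦ y s * Real.exp (-∫ x in t₁..s, a x)) 0 s := by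
    refine ((hy s).mul (hA s).neg.exp).congr_deriv ?_
    ring
  have hconst := is_const_of_deriv_eq_zero (fun s ↦ (hz s).differentiableAt)
    (fun s ↦ (hz s).deriv) t t₁
  simpa [h₁, Real.exp_ne_zero] using hconst

/-- Any solution of the instanton ODE `ψ' = 2(ψ² − ψ)` that lies in `(0,1)` at some
time belongs to the one-parameter family `ψ(τ) = (1 + e^{2(τ−τ₀)})⁻¹`. -/
theorem instanton_ode_uniqueness (ψ : ℝ → ℝ) (hdiff : Differentiable ℝ ψ)
    (hode : ∀ τ : ℝ, deriv ψ τ = 2 * ((ψ τ) ^ 2 - ψ τ))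
    (τ₁ : ℝ) (h₁ : ψ τ₁ ∈ Set.Ioo (0 : ℝ) 1) :
    ∃ τ₀ : ℝ, ∀ τ : ℝ, ψ τ = (1 + Real.exp (2 * (τ - τ₀)))⁻¹ := by
  obtain ⟨hpos, hlt⟩ := h₁
  set τ₀ := τ₁ - Real.log ((1 - ψ τ₁) / ψ τ₁) / 2 with hτ₀
  have hexp : Real.exp (2 * (τ₁ - τ₀)) = (1 - ψ τ₁) / ψ τ₁ := by
    rw [show 2 * (τ₁ - τ₀) = Real.log ((1 - ψ τ₁) / ψ τ₁) by rw [hτ₀]; ring]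
    exact Real.exp_log (div_pos (sub_pos.2 hlt) hpos)
  -- The defect `ψ (1 + e^{2(τ-τ₀)}) - 1` solves the linear equation `y' = 2ψ y`.
  have hdefect (τ : ℝ) : HasDerivAt (fun s ↦ ψ s * (1 + Real.exp (2 * (s - τ₀))) - 1)
      (2 * ψ τ * (ψ τ * (1 + Real.exp (2 * (τ - τ₀))) - 1)) τ := by
    have hψ := (hdiff τ).hasDerivAt
    rw [hode] at hψ
    have hE := ((((hasDerivAt_id τ).sub_const τ₀).const_mul 2).exp).const_add 1
    refine ((hψ.mul hE).sub_const 1).congr_deriv ?_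
    simp only [id_eq]
    ring
  have hinit : ψ τ₁ * (1 + Real.exp (2 * (τ₁ - τ₀))) - 1 = 0 := by
    rw [hexp]
    field_simp
    ring
  refine ⟨τ₀, fun τ ↦ eq_inv_of_mul_eq_one_left (sub_eq_zero.1 ?_)⟩
  exact eq_zero_of_hasDerivAt_mul_self (hdiff.continuous.const_mul 2) hdefect hinit τ
end

section
/- Let m ≥ 1 be an integer, let h ∈ ℝ satisfy e^{2h} = 2m²/(m+1), and let τ₀ ∈ ℝ. Define χ = ψ : ℝ → ℝ by ψ(τ) = (1 + e^{((m+1)/m)(τ−τ₀)})⁻¹. Then (χ, ψ) satisfies the Sasaki–Einstein instanton flow equations χ'(τ) = 2m e^{−2h}(ψ(τ)² − χ(τ)) and ψ'(τ) = ((m+1)/m)·ψ(τ)·(χ(τ) − 1) for all τ ∈ ℝ. In particular, for m = 1 (where e^{2h} = 1, i.e. h = 0) this gives the BPST-type solution χ = ψ = (1 + e^{2(τ−τ₀)})⁻¹. -/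
/-- The logistic function with rate `k` and centre `τ₀` solves `f' = k f (f - 1)`. -/
theorem hasDerivAt_inv_one_add_exp (k τ₀ τ : ℝ) :
    HasDerivAt (fun t : ℝ => (1 + Real.exp (k * (t - τ₀)))⁻¹)
      (k * (1 + Real.exp (k * (τ - τ₀)))⁻¹ * ((1 + Real.exp (k * (τ - τ₀)))⁻¹ - 1)) τ := by
  have hne : 1 + Real.exp (k * (τ - τ₀)) ≠ 0 := by positivity
  refine (((((hasDerivAt_id' τ).sub_const τ₀).const_mul k).exp.const_add 1).inv hne).congr_deriv ?_
  field_simp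
  ring

/-- For `e^{2h} = 2m²/(m+1)`, the functions `χ = ψ = (1 + e^{((m+1)/m)(τ−τ₀)})⁻¹`
solve the Sasaki–Einstein instanton flow equations
`χ' = 2m e^{−2h}(ψ² − χ)` and `ψ' = ((m+1)/m) ψ (χ − 1)`.
For `m = 1` (so `h = 0`) this is the BPST-type solution. -/
theorem sasaki_einstein_exact_solution (m : ℕ) (hm : 1 ≤ m) (h : ℝ)
    (hh : Real.exp (2 * h) = 2 * (m : ℝ) ^ 2 / ((m : ℝ) + 1)) (τ₀ : ℝ) :
    let ψ : ℝ → ℝ := fun τ => (1 + Real.exp ((((m : ℝ) + 1) / (m : ℝ)) * (τ - τ₀)))⁻¹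
    let χ : ℝ → ℝ := ψ
    (∀ τ : ℝ, deriv χ τ = 2 * (m : ℝ) * Real.exp (-(2 * h)) * ((ψ τ) ^ 2 - χ τ)) ∧
    (∀ τ : ℝ, deriv ψ τ = (((m : ℝ) + 1) / (m : ℝ)) * ψ τ * (χ τ - 1)) := by
  intro ψ χ
  have hψ (τ : ℝ) : deriv ψ τ = (((m : ℝ) + 1) / (m : ℝ)) * ψ τ * (χ τ - 1) :=
    (hasDerivAt_inv_one_add_exp _ τ₀ τ).deriv
  have hm0 : (m : ℝ) ≠ 0 := by exact_mod_cast Nat.one_le_iff_ne_zero.mp hm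
  have hk : 2 * (m : ℝ) * Real.exp (-(2 * h)) = ((m : ℝ) + 1) / (m : ℝ) := by
    rw [Real.exp_neg, hh]
    field_simp
  refine ⟨fun τ => ?_, hψ⟩
  rw [hk]
  exact (hψ τ).trans (by ring)
end

section
/- Let m ≥ 1 be an integer, let h : ℝ → ℝ be continuous, and let (χ, ψ) : ℝ → ℝ × ℝ be a differentiable solution of the Sasaki–Einstein instanton flow equations χ'(τ) = 2m e^{−2h(τ)}(ψ(τ)² − χ(τ)), ψ'(τ) = ((m+1)/m)·ψ(τ)·(χ(τ) − 1). Then the function W(τ) = χ(τ)² − 2χ(τ)ψ(τ)² + 2ψ(τ)² − 1 is differentiable and satisfies W'(τ) = −(e^{2h(τ)}/m)·χ'(τ)² − (4m/(m+1))·ψ'(τ)² ≤ 0 for all τ; in particular W is nonincreasing along every solution. -/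
/-- Along any solution of the Sasaki–Einstein instanton flow
`χ' = 2m e^{−2h}(ψ² − χ)`, `ψ' = ((m+1)/m) ψ (χ − 1)`, the potential
`W = χ² − 2χψ² + 2ψ² − 1` satisfies
`W' = −(e^{2h}/m) χ'² − (4m/(m+1)) ψ'² ≤ 0`, so `W` is nonincreasing:
the flow is a gradient flow for `W`. -/
theorem sasaki_einstein_gradient_flow (m : ℕ) (hm : 1 ≤ m) (h : ℝ → ℝ)
    (hh : Continuous h) (χ ψ : ℝ → ℝ)
    (hχ : Differentiable ℝ χ) (hψ : Differentiable ℝ ψ)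
    (hflow1 : ∀ τ : ℝ, deriv χ τ = 2 * (m : ℝ) * Real.exp (-(2 * h τ)) * ((ψ τ) ^ 2 - χ τ))
    (hflow2 : ∀ τ : ℝ, deriv ψ τ = (((m : ℝ) + 1) / (m : ℝ)) * ψ τ * (χ τ - 1)) :
    let W : ℝ → ℝ := fun τ => (χ τ) ^ 2 - 2 * χ τ * (ψ τ) ^ 2 + 2 * (ψ τ) ^ 2 - 1
    Differentiable ℝ W ∧
    (∀ τ : ℝ, deriv W τ =
      -(Real.exp (2 * h τ) / (m : ℝ)) * (deriv χ τ) ^ 2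
        - (4 * (m : ℝ) / ((m : ℝ) + 1)) * (deriv ψ τ) ^ 2) ∧
    (∀ τ : ℝ, deriv W τ ≤ 0) ∧
    Antitone W := by
  intro W
  have hm0 : (0 : ℝ) < m := by exact_mod_cast hm
  have hW : ∀ τ, HasDerivAt W
      (-(Real.exp (2 * h τ) / (m : ℝ)) * (deriv χ τ) ^ 2
        - (4 * (m : ℝ) / ((m : ℝ) + 1)) * (deriv ψ τ) ^ 2) τ := by
    intro τ
    have hc := (hχ τ).hasDerivAt
    have hp := (hψ τ).hasDerivAt
    have key := (((hc.pow 2).sub ((hc.const_mul 2).mul (hp.pow 2))).add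
      ((hp.pow 2).const_mul 2)).sub_const 1
    refine key.congr_deriv ?_
    have hχ_term : Real.exp (2 * h τ) / (m : ℝ) * (deriv χ τ) ^ 2
        = 2 * deriv χ τ * ((ψ τ) ^ 2 - χ τ) := by
      rw [hflow1 τ, Real.exp_neg]
      field_simp
    have hψ_term : 4 * (m : ℝ) / ((m : ℝ) + 1) * (deriv ψ τ) ^ 2
        = 4 * ψ τ * deriv ψ τ * (χ τ - 1) := by
      rw [hflow2 τ]
      field_simp
    rw [neg_mul, hχ_term, hψ_term]
    simp only [Pi.pow_apply]
    push_cast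
    ring
  have hW_nonpos : ∀ τ, deriv W τ ≤ 0 := by
    intro τ
    rw [(hW τ).deriv, neg_mul, ← neg_add', neg_nonpos]
    positivity
  have hW_diff : Differentiable ℝ W := fun τ => (hW τ).differentiableAt
  exact ⟨hW_diff, fun τ => (hW τ).deriv, hW_nonpos, antitone_of_deriv_nonpos hW_diff hW_nonpos⟩
end

section
/- For every τ₀ ∈ ℝ and every sign ε ∈ {+1, −1}, the functions χ(τ) = (1 + e^{2(τ−τ₀)})⁻¹ and ψ(τ) = ε·(1 + e^{2(τ−τ₀)})^{−1/2} are differentiable on ℝ and satisfy the 3-Sasakian instanton system: χ(τ) = ψ(τ)², χ'(τ) = 2χ(τ)(χ(τ) − 1), and ψ'(τ) = ψ(τ)(χ(τ) − 1) for all τ ∈ ℝ. -/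
/-- The one-parameter family `χ = (1 + e^{2(τ−τ₀)})⁻¹`, `ψ = ±(1 + e^{2(τ−τ₀)})^{−1/2}`
solves the 3-Sasakian instanton system: the algebraic constraint `χ = ψ²` together with
the flow equations `χ' = 2χ(χ−1)` and `ψ' = ψ(χ−1)`. -/
theorem three_sasakian_instanton_solution (τ₀ ε : ℝ) (hε : ε = 1 ∨ ε = -1) :
    let χ : ℝ → ℝ := fun τ => (1 + Real.exp (2 * (τ - τ₀)))⁻¹
    let ψ : ℝ → ℝ := fun τ => ε * (1 + Real.exp (2 * (τ - τ₀))) ^ (-(1 : ℝ) / 2)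
    Differentiable ℝ χ ∧ Differentiable ℝ ψ ∧
    (∀ τ : ℝ, χ τ = (ψ τ) ^ 2) ∧
    (∀ τ : ℝ, deriv χ τ = 2 * χ τ * (χ τ - 1)) ∧
    (∀ τ : ℝ, deriv ψ τ = ψ τ * (χ τ - 1)) := by
  intro χ ψ
  have hu_pos (τ : ℝ) : 0 < 1 + Real.exp (2 * (τ - τ₀)) := by positivity
  have hu (τ : ℝ) : HasDerivAt (fun τ => 1 + Real.exp (2 * (τ - τ₀)))
      (Real.exp (2 * (τ - τ₀)) * 2) τ := by
    simpa using ((((hasDerivAt_id τ).sub_const τ₀).const_mul 2).exp.const_add 1)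
  have hχ (τ : ℝ) : HasDerivAt χ (2 * χ τ * (χ τ - 1)) τ := by
    refine ((hu τ).inv (hu_pos τ).ne').congr_deriv ?_
    have := (hu_pos τ).ne'
    simp only [χ]
    field_simp
    ring
  have hψ (τ : ℝ) : HasDerivAt ψ (ψ τ * (χ τ - 1)) τ := by
    refine (((hu τ).rpow_const (p := -(1 : ℝ) / 2)
      (Or.inl (hu_pos τ).ne')).const_mul ε).congr_deriv ?_
    have := (hu_pos τ).ne'
    simp only [χ, ψ]
    rw [Real.rpow_sub_one this]
    field_simp
    ring
  refine ⟨fun τ => (hχ τ).differentiableAt, fun τ => (hψ τ).differentiableAt, fun τ => ?_,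
    fun τ => (hχ τ).deriv, fun τ => (hψ τ).deriv⟩
  have hε_sq : ε ^ 2 = 1 := by rcases hε with rfl | rfl <;> norm_num
  simp only [χ, ψ]
  rw [mul_pow, hε_sq, one_mul, ← Real.rpow_mul_natCast (hu_pos τ).le, ← Real.rpow_neg_one]
  norm_num
end

section
/- Let χ, ψ : ℝ → ℝ be differentiable functions satisfying χ'(τ) = 2χ(τ)(χ(τ) − 1) and ψ'(τ) = ψ(τ)(χ(τ) − 1) for all τ ∈ ℝ, and suppose χ(τ₁) = ψ(τ₁)² for some τ₁ ∈ ℝ. Then χ(τ) = ψ(τ)² for all τ ∈ ℝ. -/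
/-- A solution of the homogeneous linear equation `w' = a w` with continuous coefficient
that vanishes at one time vanishes identically. -/
theorem eq_zero_of_hasDerivAt_mul_of_eq_zero {a w : ℝ → ℝ} (ha : Continuous a)
    (hw : ∀ t, HasDerivAt w (a t * w t) t) {t₀ : ℝ} (h₀ : w t₀ = 0) (t : ℝ) : w t = 0 := by
  have hA (s : ℝ) : HasDerivAt (fun s => ∫ x in t₀..s, a x) (a s) s :=
    ha.integral_hasStrictDerivAt t₀ s |>.hasDerivAt
  have hd (s : ℝ) : HasDerivAt (fun s => w s * Real.exp (-∫ x in t₀..s, a x)) 0 s :=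
    ((hw s).mul (hA s).neg.exp).congr_deriv (by ring)
  have h := is_const_of_deriv_eq_zero (fun s => (hd s).differentiableAt)
    (fun s => (hd s).deriv) t t₀
  simpa [h₀, Real.exp_ne_zero] using h

/-- The constraint `χ = ψ²` is conserved by the 3-Sasakian instanton flow
`χ' = 2χ(χ−1)`, `ψ' = ψ(χ−1)`: if it holds at one time it holds for all times. -/
theorem three_sasakian_constraint_conserved (χ ψ : ℝ → ℝ)
    (hχ : Differentiable ℝ χ) (hψ : Differentiable ℝ ψ)
    (hflow1 : ∀ τ : ℝ, deriv χ τ = 2 * χ τ * (χ τ - 1))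
    (hflow2 : ∀ τ : ℝ, deriv ψ τ = ψ τ * (χ τ - 1))
    (τ₁ : ℝ) (hinit : χ τ₁ = (ψ τ₁) ^ 2) :
    ∀ τ : ℝ, χ τ = (ψ τ) ^ 2 := by
  have hw (t : ℝ) : HasDerivAt (fun s => χ s - ψ s ^ 2)
      (2 * (χ t - 1) * (χ t - ψ t ^ 2)) t := by
    refine ((hχ t).hasDerivAt.sub ((hψ t).hasDerivAt.pow 2)).congr_deriv ?_
    rw [hflow1, hflow2]
    push_cast
    ring
  have ha : Continuous fun t => 2 * (χ t - 1) := by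
    have := hχ.continuous
    fun_prop
  exact fun τ => sub_eq_zero.mp
    (eq_zero_of_hasDerivAt_mul_of_eq_zero ha hw (sub_eq_zero.mpr hinit) τ)
end

section
/- Let α' ≥ 0 and τ₀ ∈ ℝ, and let ψ(τ) = (1 + e^{2(τ−τ₀)})⁻¹. Define f : ℝ → ℝ by f(τ) = ½·log(e^{2τ} + (α'/2)(1 − ψ(τ)²)) (the argument of the logarithm is strictly positive). Then f is differentiable and satisfies e^{2f(τ)}·(f'(τ) − 1) = −(α'/2)·(1 − ψ(τ))²·(1 + 2ψ(τ)) for all τ ∈ ℝ. -/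
/-- The profile `ψ(τ) = (1 + e^{2(τ−τ₀)})⁻¹` solves the instanton equation `ψ' = 2(ψ² − ψ)`. -/
theorem hasDerivAt_instanton_profile (τ₀ τ : ℝ) :
    HasDerivAt (fun t : ℝ => (1 + Real.exp (2 * (t - τ₀)))⁻¹)
      (2 * (((1 + Real.exp (2 * (τ - τ₀)))⁻¹) ^ 2 - (1 + Real.exp (2 * (τ - τ₀)))⁻¹)) τ := by
  have hpos : 0 < 1 + Real.exp (2 * (τ - τ₀)) := by positivity
  have h := (((((hasDerivAt_id τ).sub_const τ₀).const_mul 2).exp).const_add 1).inv hpos.ne'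
  refine h.congr_deriv ?_
  simp only [id]
  field_simp
  ring

/-- Exact integration of the heterotic Bianchi identity on the cone over a nearly Kähler
or nearly parallel G₂ manifold: with `ψ(τ) = (1 + e^{2(τ−τ₀)})⁻¹` and
`e^{2f} = e^{2τ} + (α'/2)(1 − ψ²)`, the conformal factor `f` satisfies
`e^{2f}(f' − 1) = −(α'/2)(1 − ψ)²(1 + 2ψ)`. -/
theorem heterotic_bianchi_nk_g2 (α' : ℝ) (hα : 0 ≤ α') (τ₀ : ℝ) :
    let ψ : ℝ → ℝ := fun τ => (1 + Real.exp (2 * (τ - τ₀)))⁻¹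
    let f : ℝ → ℝ := fun τ =>
      (1 / 2) * Real.log (Real.exp (2 * τ) + (α' / 2) * (1 - (ψ τ) ^ 2))
    (∀ τ : ℝ, 0 < Real.exp (2 * τ) + (α' / 2) * (1 - (ψ τ) ^ 2)) ∧
    Differentiable ℝ f ∧
    (∀ τ : ℝ, Real.exp (2 * f τ) * (deriv f τ - 1)
      = -(α' / 2) * (1 - ψ τ) ^ 2 * (1 + 2 * ψ τ)) := by
  intro ψ f
  have hψ (τ : ℝ) : HasDerivAt ψ (2 * (ψ τ ^ 2 - ψ τ)) τ := hasDerivAt_instanton_profile τ₀ τ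
  have hpos (τ : ℝ) : 0 < Real.exp (2 * τ) + (α' / 2) * (1 - (ψ τ) ^ 2) := by
    have h0 : 0 ≤ ψ τ := by positivity
    have h1 : ψ τ ≤ 1 := inv_le_one_of_one_le₀ (by linarith [Real.exp_pos (2 * (τ - τ₀))])
    have h2 : 0 ≤ 1 - ψ τ ^ 2 := by nlinarith
    positivity
  have hf (τ : ℝ) : HasDerivAt f
      ((Real.exp (2 * τ) - (α' / 2) * (2 * ψ τ * (ψ τ ^ 2 - ψ τ))) /
        (Real.exp (2 * τ) + (α' / 2) * (1 - (ψ τ) ^ 2))) τ := by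
    have hexp := ((hasDerivAt_id τ).const_mul 2).exp
    have hquad := (((hψ τ).pow 2).const_sub 1).const_mul (α' / 2)
    refine (((hexp.add hquad).log (hpos τ).ne').const_mul (1 / 2)).congr_deriv ?_
    simp only [id]
    rw [← mul_div_assoc]
    congr 1
    ring
  refine ⟨hpos, fun τ => (hf τ).differentiableAt, fun τ => ?_⟩
  have hexp : Real.exp (2 * f τ) = Real.exp (2 * τ) + (α' / 2) * (1 - (ψ τ) ^ 2) := by
    rw [← Real.exp_log (hpos τ)]
    congr 1
    simp only [f]
    ring
  rw [(hf τ).deriv, hexp, mul_sub, mul_div_cancel₀ _ (hpos τ).ne']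
  ring
end

section
/- Let α' ≥ 0 and τ₀ ∈ ℝ, and let χ(τ) = (1 + e^{2(τ−τ₀)})⁻¹. Define f, h : ℝ → ℝ by e^{2f(τ)} = e^{2τ} + (α'/4)(1 − χ(τ)²) and e^{2(f(τ)+h(τ))} = e^{2τ} + (α'/2)(1 − χ(τ)) (both right-hand sides are strictly positive, so f and h are well-defined and differentiable). Then for all τ ∈ ℝ: (i) f'(τ) + h'(τ) = 2e^{−2h(τ)} − 1; (ii) e^{2f(τ)}·(f'(τ) − 1) = −(α'/4)·(1 + 2χ(τ))·(1 − χ(τ))²; and (iii) e^{2(f(τ)+h(τ))}·(f'(τ) + h'(τ) − 1) = −(α'/2)·(1 − χ(τ))². -/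
/-- The 3-Sasakian instanton flow equation `χ' = 2χ(χ − 1)`. -/
theorem hasDerivAt_instanton (τ₀ τ : ℝ) :
    HasDerivAt (fun τ => (1 + Real.exp (2 * (τ - τ₀)))⁻¹)
      (2 * (1 + Real.exp (2 * (τ - τ₀)))⁻¹ * ((1 + Real.exp (2 * (τ - τ₀)))⁻¹ - 1)) τ := by
  have hne : 1 + Real.exp (2 * (τ - τ₀)) ≠ 0 := by positivity
  have hd : HasDerivAt (fun τ => 1 + Real.exp (2 * (τ - τ₀)))
      (Real.exp (2 * (τ - τ₀)) * (2 * 1)) τ :=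
    ((((hasDerivAt_id τ).sub_const τ₀).const_mul 2).exp).const_add 1
  refine HasDerivAt.congr_deriv (hd.inv hne) ?_
  field_simp
  ring

theorem exp_two_mul_half_log {x : ℝ} (hx : 0 < x) :
    Real.exp (2 * ((1 / 2) * Real.log x)) = x := by
  rw [← mul_assoc, show (2 : ℝ) * (1 / 2) = 1 by norm_num, one_mul, Real.exp_log hx]

theorem HasDerivAt.half_log {F : ℝ → ℝ} {F' x : ℝ} (hF : HasDerivAt F F' x) (hx : 0 < F x) :
    HasDerivAt (fun t => (1 / 2) * Real.log (F t)) (F' / (2 * F x)) x := by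
  refine HasDerivAt.congr_deriv ((hF.log hx.ne').const_mul (1 / 2)) ?_
  field_simp


/-- The exact analytic solution of the reduced heterotic supergravity equations on the
cone over a 3-Sasakian manifold: with `χ(τ) = (1 + e^{2(τ−τ₀)})⁻¹` and `f, h` defined by
`e^{2f} = e^{2τ} + (α'/4)(1 − χ²)` and `e^{2(f+h)} = e^{2τ} + (α'/2)(1 − χ)`,
one has (i) `f' + h' = 2e^{−2h} − 1`, (ii) `e^{2f}(f'−1) = −(α'/4)(1+2χ)(1−χ)²`, and
(iii) `e^{2(f+h)}(f'+h'−1) = −(α'/2)(1−χ)²`. -/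
theorem heterotic_three_sasakian (α' : ℝ) (hα : 0 ≤ α') (τ₀ : ℝ) :
    let χ : ℝ → ℝ := fun τ => (1 + Real.exp (2 * (τ - τ₀)))⁻¹
    let f : ℝ → ℝ := fun τ =>
      (1 / 2) * Real.log (Real.exp (2 * τ) + (α' / 4) * (1 - (χ τ) ^ 2))
    let h : ℝ → ℝ := fun τ =>
      (1 / 2) * Real.log (Real.exp (2 * τ) + (α' / 2) * (1 - χ τ)) - f τ
    (∀ τ : ℝ, 0 < Real.exp (2 * τ) + (α' / 4) * (1 - (χ τ) ^ 2)) ∧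
    (∀ τ : ℝ, 0 < Real.exp (2 * τ) + (α' / 2) * (1 - χ τ)) ∧
    Differentiable ℝ f ∧ Differentiable ℝ h ∧
    (∀ τ : ℝ, Real.exp (2 * f τ) = Real.exp (2 * τ) + (α' / 4) * (1 - (χ τ) ^ 2)) ∧
    (∀ τ : ℝ, Real.exp (2 * (f τ + h τ)) = Real.exp (2 * τ) + (α' / 2) * (1 - χ τ)) ∧
    (∀ τ : ℝ, deriv f τ + deriv h τ = 2 * Real.exp (-(2 * h τ)) - 1) ∧
    (∀ τ : ℝ, Real.exp (2 * f τ) * (deriv f τ - 1)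
      = -(α' / 4) * (1 + 2 * χ τ) * (1 - χ τ) ^ 2) ∧
    (∀ τ : ℝ, Real.exp (2 * (f τ + h τ)) * (deriv f τ + deriv h τ - 1)
      = -(α' / 2) * (1 - χ τ) ^ 2) := by
  intro χ f h
  have hχ (τ : ℝ) : HasDerivAt χ (2 * χ τ * (χ τ - 1)) τ := hasDerivAt_instanton τ₀ τ
  have hχ_pos (τ : ℝ) : 0 < χ τ := by positivity
  have hχ_le (τ : ℝ) : χ τ ≤ 1 := inv_le_one_of_one_le₀ (by linarith [Real.exp_pos (2 * (τ - τ₀))])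
  have hexp (τ : ℝ) : HasDerivAt (fun t => Real.exp (2 * t)) (2 * Real.exp (2 * τ)) τ := by
    simpa [mul_comm] using ((hasDerivAt_id τ).const_mul 2).exp
  set F : ℝ → ℝ := fun τ => Real.exp (2 * τ) + (α' / 4) * (1 - (χ τ) ^ 2) with hFdef
  set G : ℝ → ℝ := fun τ => Real.exp (2 * τ) + (α' / 2) * (1 - χ τ) with hGdef
  have hF_pos (τ : ℝ) : 0 < F τ :=
    add_pos_of_pos_of_nonneg (Real.exp_pos _)
      (mul_nonneg (by positivity) (by nlinarith [hχ_pos τ, hχ_le τ]))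
  have hG_pos (τ : ℝ) : 0 < G τ :=
    add_pos_of_pos_of_nonneg (Real.exp_pos _)
      (mul_nonneg (by positivity) (sub_nonneg.2 (hχ_le τ)))
  have hF (τ : ℝ) :
      HasDerivAt F (2 * Real.exp (2 * τ) + α' * χ τ ^ 2 * (1 - χ τ)) τ := by
    refine HasDerivAt.congr_deriv ((hexp τ).add ((((hχ τ).pow 2).const_sub 1).const_mul (α' / 4))) ?_
    push_cast
    ring
  have hG (τ : ℝ) :
      HasDerivAt G (2 * Real.exp (2 * τ) + α' * χ τ * (1 - χ τ)) τ := by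
    refine HasDerivAt.congr_deriv ((hexp τ).add (((hχ τ).const_sub 1).const_mul (α' / 2))) ?_
    ring
  have hf (τ : ℝ) : HasDerivAt f _ τ := (hF τ).half_log (hF_pos τ)
  have hh (τ : ℝ) : HasDerivAt h _ τ := ((hG τ).half_log (hG_pos τ)).sub (hf τ)
  have hsum (τ : ℝ) : f τ + h τ = (1 / 2) * Real.log (G τ) := add_sub_cancel _ _
  have hexp_f (τ : ℝ) : Real.exp (2 * f τ) = F τ := exp_two_mul_half_log (hF_pos τ)
  have hexp_fh (τ : ℝ) : Real.exp (2 * (f τ + h τ)) = G τ := by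
    rw [hsum, exp_two_mul_half_log (hG_pos τ)]
  have hexp_h (τ : ℝ) : Real.exp (-(2 * h τ)) = F τ / G τ := by
    rw [← hexp_f, ← hexp_fh, ← Real.exp_sub]
    ring_nf
  refine ⟨hF_pos, hG_pos, fun τ => (hf τ).differentiableAt, fun τ => (hh τ).differentiableAt,
    hexp_f, hexp_fh, fun τ => ?_, fun τ => ?_, fun τ => ?_⟩
  · have hne := (hG_pos τ).ne'
    rw [hexp_h, (hf τ).deriv, (hh τ).deriv, add_sub_cancel]
    field_simp
    simp only [hFdef, hGdef]
    ring
  · have hne := (hF_pos τ).ne'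
    rw [hexp_f, (hf τ).deriv]
    field_simp
    simp only [hFdef]
    ring
  · have hne := (hG_pos τ).ne'
    rw [hexp_fh, (hf τ).deriv, (hh τ).deriv, add_sub_cancel]
    field_simp
    simp only [hGdef]
    ring
end

section
/- In the exterior algebra Λ(ℝ⁶), let e₁,…,e₆ denote the images of the standard basis vectors, let Q = e₁∧e₂∧e₃∧e₄ + e₁∧e₂∧e₅∧e₆ + e₃∧e₄∧e₅∧e₆, and let P : Fin 6 → Fin 6 → Fin 6 → ℝ be the totally antisymmetric tensor determined by P(1,3,5) = 1, P(1,4,6) = −1, P(2,3,6) = −1, P(2,4,5) = −1 (all components not obtained from these by permutations being zero). Then Σ_{a,b,c,d,e} P(a,b,c)·P(a,d,e) • (e_b ∧ e_c ∧ e_d ∧ e_e) = 16 • Q, where the sum runs over all quintuples of indices. -/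
/-- The image of the `i`-th standard basis vector of `ℝ⁶` in the exterior algebra
`Λ(ℝ⁶)` (indices shifted: `extE 0` is the vector `e₁`, …, `extE 5` is `e₆`). -/
noncomputable def extE (i : Fin 6) : ExteriorAlgebra ℝ (Fin 6 → ℝ) :=
  ExteriorAlgebra.ι ℝ (Pi.single i 1)

theorem extE_mul_self (i : Fin 6) : extE i * extE i = 0 :=
  ExteriorAlgebra.ι_sq_zero _

theorem extE_mul_comm_of_lt {i j : Fin 6} (_ : i < j) :
    extE j * extE i = -(extE i * extE j) :=
  eq_neg_of_add_eq_zero_left (ExteriorAlgebra.ι_add_mul_swap _ _)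

theorem extE_mul_left_comm_of_lt {i j : Fin 6} (h : i < j)
    (t : ExteriorAlgebra ℝ (Fin 6 → ℝ)) :
    extE j * (extE i * t) = -(extE i * (extE j * t)) := by
  rw [← mul_assoc, extE_mul_comm_of_lt h, neg_mul, mul_assoc]

theorem antisymm_perm_values {ι : Type*} {P : ι → ι → ι → ℝ}
    (hP1 : ∀ x y z, P x y z = - P y x z) (hP2 : ∀ x y z, P x y z = - P x z y)
    {x y z : ι} {r : ℝ} (h : P x y z = r) :
    P x z y = -r ∧ P y x z = -r ∧ P y z x = r ∧ P z x y = r ∧ P z y x = -r := by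
  have hxzy : P x z y = -r := by rw [hP2, h]
  have hyxz : P y x z = -r := by rw [hP1, h]
  have hyzx : P y z x = r := by rw [hP2, hyxz, neg_neg]
  have hzxy : P z x y = r := by rw [hP1, hxzy, neg_neg]
  exact ⟨hxzy, hyxz, hyzx, hzxy, by rw [hP2, hzxy]⟩

theorem sum_contraction_eq_sum_sq {ι A : Type*} [Fintype ι] [Ring A] [Algebra ℝ A]
    (P : ι → ι → ι → ℝ) (v : ι → A) :
    ∑ a, ∑ b, ∑ c, ∑ d, ∑ e, (P a b c * P a d e) • (v b * v c * v d * v e)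
      = ∑ a, (∑ b, ∑ c, P a b c • (v b * v c)) * (∑ d, ∑ e, P a d e • (v d * v e)) := by
  simp only [Finset.sum_mul]
  simp only [Finset.mul_sum, smul_mul_smul_comm, mul_assoc]

/-- The quadratic contraction identity `Σ P_{abc} P_{ade} e^b∧e^c∧e^d∧e^e = 16 Q` for the
standard nearly Kähler 3-form `P = e¹³⁵ − e¹⁴⁶ − e²³⁶ − e²⁴⁵` on `ℝ⁶` and the SU(3)
Casimir 4-form `Q = e¹²³⁴ + e¹²⁵⁶ + e³⁴⁵⁶` (indices shifted down by one in `Fin 6`). -/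
theorem nearly_kaehler_contraction
    (P : Fin 6 → Fin 6 → Fin 6 → ℝ)
    (hP1 : ∀ x y z, P x y z = - P y x z)
    (hP2 : ∀ x y z, P x y z = - P x z y)
    (hv1 : P 0 2 4 = 1) (hv2 : P 0 3 5 = -1) (hv3 : P 1 2 5 = -1) (hv4 : P 1 3 4 = -1)
    (hzero : ∀ x y z : Fin 6,
      ({x, y, z} : Finset (Fin 6)) ≠ {0, 2, 4} →
      ({x, y, z} : Finset (Fin 6)) ≠ {0, 3, 5} →
      ({x, y, z} : Finset (Fin 6)) ≠ {1, 2, 5} →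
      ({x, y, z} : Finset (Fin 6)) ≠ {1, 3, 4} → P x y z = 0) :
    ∑ a : Fin 6, ∑ b : Fin 6, ∑ c : Fin 6, ∑ d : Fin 6, ∑ e : Fin 6,
        (P a b c * P a d e) • (extE b * extE c * extE d * extE e)
      = (16 : ℝ) • (extE 0 * extE 1 * extE 2 * extE 3
          + extE 0 * extE 1 * extE 4 * extE 5
          + extE 2 * extE 3 * extE 4 * extE 5) := by
  obtain ⟨a1, a2, a3, a4, a5⟩ := antisymm_perm_values hP1 hP2 hv1
  obtain ⟨b1, b2, b3, b4, b5⟩ := antisymm_perm_values hP1 hP2 hv2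
  obtain ⟨c1, c2, c3, c4, c5⟩ := antisymm_perm_values hP1 hP2 hv3
  obtain ⟨d1, d2, d3, d4, d5⟩ := antisymm_perm_values hP1 hP2 hv4
  have form (a : Fin 6) : ∑ b, ∑ c, P a b c • (extE b * extE c) =
      (2 : ℝ) • ![extE 2 * extE 4 - extE 3 * extE 5, -(extE 2 * extE 5) - extE 3 * extE 4,
        extE 1 * extE 5 - extE 0 * extE 4, extE 0 * extE 5 + extE 1 * extE 4,
        extE 0 * extE 2 - extE 1 * extE 3, -(extE 0 * extE 3) - extE 1 * extE 2] a := by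
    fin_cases a <;>
    · simp (disch := decide) [Fin.sum_univ_six, hzero, hv1, hv2, hv3, hv4, a1, a2, a3, a4, a5,
        b1, b2, b3, b4, b5, c1, c2, c3, c4, c5, d1, d2, d3, d4, d5, extE_mul_comm_of_lt]
      module
  rw [sum_contraction_eq_sum_sq]
  simp only [form]
  simp (disch := decide) [Fin.sum_univ_six, mul_assoc, mul_add, add_mul, mul_sub, sub_mul,
    extE_mul_self, extE_mul_comm_of_lt, extE_mul_left_comm_of_lt]
  module
end
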